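/- Let μ ∈ (0,1) and γ ∈ (0,1). For n ≥ 0 set c_n = (1/γ³)(μ + (−1)ⁿ (1−μ) γ^{n+1}/(1−γ)^{n+1}). Let (x,y,z) ∈ ℝ³ with √(x²+y²+z²) < min(1, (1−γ)/γ), and define X = −γx + μ − 1 + γ, Y = −γy, Z = γz, r₁ = √((X−μ)² + Y² + Z²), r₂ = √((X+1−μ)² + Y² + Z²). Then (1−μ)/r₁ + μ/r₂ = γ² ∑_{n=0}^∞ c_n T_n(x,y,z), with the series converging absolutely. -/

import Mathlib

/-- The functions `T_n(x,y,z) = ρⁿ 𝒫_n(x/ρ)` defined by the Legendre recursion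
`T₀ = 1`, `T₁ = x`, `T_n = ((2n−1)/n) x T_{n−1} − ((n−1)/n)(x²+y²+z²) T_{n−2}`. -/
noncomputable def legendreT (x y z : ℝ) : ℕ → ℝ
  | 0 => 1
  | 1 => x
  | n + 2 =>
      ((2 * ((n : ℝ) + 2) - 1) / ((n : ℝ) + 2)) * x * legendreT x y z (n + 1)
        - (((n : ℝ) + 1) / ((n : ℝ) + 2)) * (x ^ 2 + y ^ 2 + z ^ 2) * legendreT x y z n

/-- The coefficients `c_n` of the Legendre-type expansion of the gravitational
potential around `L₁`: `c_n = (1/γ³)(μ + (−1)ⁿ (1−μ) γ^{n+1}/(1−γ)^{n+1})`. -/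
noncomputable def cCoeffL1 (μ γ : ℝ) (n : ℕ) : ℝ :=
  (1 / γ ^ 3) * (μ + (-1 : ℝ) ^ n * (1 - μ) * γ ^ (n + 1) / (1 - γ) ^ (n + 1))

/-- The formal power series of `(1 - w X)^(-1/2)`. -/
noncomputable def invSqrtSeries (w : ℂ) : PowerSeries ℂ :=
  PowerSeries.mk fun k => (Nat.centralBinom k : ℂ) / 4 ^ k * w ^ k

open PowerSeries in
lemma invSqrtSeries_derivative (w : ℂ) :
    (1 - C w * X) * derivative ℂ (invSqrtSeries w) = C (w / 2) * invSqrtSeries w := by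
  have step (n : ℕ) : ((n : ℂ) + 1) * (Nat.centralBinom (n + 1) : ℂ)
      = 2 * (2 * n + 1) * Nat.centralBinom n := by
    exact_mod_cast Nat.succ_mul_centralBinom_succ n
  ext n
  rw [sub_mul, one_mul, mul_assoc, map_sub, coeff_C_mul, coeff_C_mul, coeff_derivative]
  cases n with
  | zero =>
    have h := step 0
    simp [invSqrtSeries] at h ⊢
    rw [h]; ring
  | succ n =>
    have h := step (n + 1)
    rw [coeff_succ_X_mul, coeff_derivative]
    simp only [invSqrtSeries, coeff_mk]
    push_cast at h ⊢
    rw [pow_succ 4 (n + 1)]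
    field_simp
    linear_combination 2 * w ^ (n + 2) * h

open PowerSeries in
/-- The coefficients of `(1 - w X)^(-1/2) (1 - v X)^(-1/2)` obey Legendre's recursion. -/
lemma coeff_invSqrtSeries_mul_recurrence (w v : ℂ) (n : ℕ) :
    ((n : ℂ) + 2) * coeff (n + 2) (invSqrtSeries w * invSqrtSeries v)
      = (2 * n + 3) * ((w + v) / 2) * coeff (n + 1) (invSqrtSeries w * invSqrtSeries v)
        - (n + 1) * (w * v) * coeff n (invSqrtSeries w * invSqrtSeries v) := by
  set F := invSqrtSeries w * invSqrtSeries v with hF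
  have hC (u : ℂ) : (C u : PowerSeries ℂ) = 2 * C (u / 2) := by
    rw [two_mul, ← map_add, add_halves]
  have ode : derivative ℂ F - C (w + v) * (X * derivative ℂ F)
      + C (w * v) * (X * (X * derivative ℂ F)) = C ((w + v) / 2) * F - C (w * v) * (X * F) := by
    have hw := invSqrtSeries_derivative w
    have hv := invSqrtSeries_derivative v
    have hd : derivative ℂ F = invSqrtSeries w * derivative ℂ (invSqrtSeries v)
        + invSqrtSeries v * derivative ℂ (invSqrtSeries w) := by
      simp [hF, Derivation.leibniz]
    rw [hd, hF, add_div]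
    simp only [map_add, map_mul]
    rw [hC w] at hw ⊢
    rw [hC v] at hv ⊢
    linear_combination (1 - 2 * C (v / 2) * X) * invSqrtSeries v * hw
      + (1 - 2 * C (w / 2) * X) * invSqrtSeries w * hv
  have h := congrArg (coeff (n + 1)) ode
  rw [map_add, map_sub, map_sub] at h
  simp only [coeff_C_mul, coeff_succ_X_mul, coeff_derivative] at h
  cases n with
  | zero =>
    simp only [coeff_zero_X_mul] at h
    push_cast at h ⊢
    linear_combination h
  | succ n =>
    simp only [coeff_succ_X_mul, coeff_derivative] at h
    push_cast at h ⊢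
    linear_combination h

lemma coeff_zero_invSqrtSeries_mul (w v : ℂ) :
    PowerSeries.coeff 0 (invSqrtSeries w * invSqrtSeries v) = 1 := by
  simp [invSqrtSeries]

lemma coeff_one_invSqrtSeries_mul (w v : ℂ) :
    PowerSeries.coeff 1 (invSqrtSeries w * invSqrtSeries v) = (w + v) / 2 := by
  have h : Nat.centralBinom 1 = 2 := rfl
  simp [invSqrtSeries, PowerSeries.coeff_mul, Finset.Nat.antidiagonal_succ, h]
  ring

lemma coeff_invSqrtSeries_mul_self (w : ℂ) (n : ℕ) :
    PowerSeries.coeff n (invSqrtSeries w * invSqrtSeries w) = w ^ n := by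
  induction n using Nat.twoStepInduction with
  | zero => simpa using coeff_zero_invSqrtSeries_mul w w
  | one => rw [coeff_one_invSqrtSeries_mul]; ring
  | more n ih0 ih1 =>
    have h := coeff_invSqrtSeries_mul_recurrence w w n
    rw [ih0, ih1] at h
    have hn : (n : ℂ) + 2 ≠ 0 := by exact_mod_cast (Nat.succ_ne_zero (n + 1))
    apply mul_left_cancel₀ hn
    rw [h]; ring

lemma coeff_invSqrtSeries_mul_eq_legendreT {x y z : ℝ} {w v : ℂ}
    (hadd : w + v = 2 * x) (hmul : w * v = ((x ^ 2 + y ^ 2 + z ^ 2 : ℝ) : ℂ)) (n : ℕ) :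
    PowerSeries.coeff n (invSqrtSeries w * invSqrtSeries v) = legendreT x y z n := by
  induction n using Nat.twoStepInduction with
  | zero => simpa [legendreT] using coeff_zero_invSqrtSeries_mul w v
  | one => rw [coeff_one_invSqrtSeries_mul, hadd]; simp [legendreT]
  | more n ih0 ih1 =>
    have h := coeff_invSqrtSeries_mul_recurrence w v n
    rw [ih0, ih1, hadd, hmul] at h
    have hn : (n : ℂ) + 2 ≠ 0 := by exact_mod_cast (Nat.succ_ne_zero (n + 1))
    apply mul_left_cancel₀ hn
    rw [h, legendreT]
    push_cast
    field_simp
    ring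

lemma summable_norm_coeff_invSqrtSeries {w : ℂ} (hw : ‖w‖ < 1) :
    Summable fun n => ‖PowerSeries.coeff n (invSqrtSeries w)‖ := by
  refine (summable_geometric_of_lt_one (norm_nonneg w) hw).of_nonneg_of_le
    (fun _ => norm_nonneg _) fun n => ?_
  have hc : (Nat.centralBinom n : ℝ) ≤ 4 ^ n := by exact_mod_cast Nat.centralBinom_le_four_pow n
  simp only [invSqrtSeries, PowerSeries.coeff_mk, norm_mul, norm_div, norm_pow, Complex.norm_natCast,
    Complex.norm_ofNat]
  exact mul_le_of_le_one_left (by positivity) ((div_le_one (by positivity)).2 hc)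

/-- The Cauchy product of the series of `(1 - w)^(-1/2)` and `(1 - v)^(-1/2)`. -/
lemma hasSum_coeff_invSqrtSeries_mul {w v : ℂ} (hw : ‖w‖ < 1) (hv : ‖v‖ < 1) :
    (Summable fun n => ‖PowerSeries.coeff n (invSqrtSeries w * invSqrtSeries v)‖) ∧
    HasSum (fun n => PowerSeries.coeff n (invSqrtSeries w * invSqrtSeries v))
      ((∑' n, PowerSeries.coeff n (invSqrtSeries w)) *
        ∑' n, PowerSeries.coeff n (invSqrtSeries v)) := by
  have sw := summable_norm_coeff_invSqrtSeries hw
  have sv := summable_norm_coeff_invSqrtSeries hv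
  have hs := summable_norm_sum_mul_antidiagonal_of_summable_norm sw sv
  simp only [PowerSeries.coeff_mul]
  refine ⟨hs, ?_⟩
  rw [tsum_mul_tsum_eq_tsum_sum_antidiagonal_of_summable_norm sw sv]
  exact hs.of_norm.hasSum

lemma tsum_coeff_invSqrtSeries_sq {w : ℂ} (hw : ‖w‖ < 1) :
    (∑' n, PowerSeries.coeff n (invSqrtSeries w)) ^ 2 = (1 - w)⁻¹ := by
  have h := (hasSum_coeff_invSqrtSeries_mul hw hw).2
  simp only [coeff_invSqrtSeries_mul_self] at h
  rw [sq]
  exact h.unique (hasSum_geometric_of_norm_lt_one hw)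

open ComplexConjugate in
lemma tsum_coeff_invSqrtSeries_conj (w : ℂ) :
    ∑' n, PowerSeries.coeff n (invSqrtSeries (conj w))
      = conj (∑' n, PowerSeries.coeff n (invSqrtSeries w)) := by
  rw [Complex.conj_tsum]
  have h4 : conj (4 : ℂ) = 4 := Complex.conj_ofNat 4
  simp [invSqrtSeries, h4]

open ComplexConjugate in
/-- The generating function of the Legendre polynomials, evaluated inside the unit ball. -/
theorem hasSum_legendreT {x y z : ℝ} (h : x ^ 2 + y ^ 2 + z ^ 2 < 1) :
    (Summable fun n => |legendreT x y z n|) ∧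
    HasSum (legendreT x y z) (1 / √(1 - 2 * x + (x ^ 2 + y ^ 2 + z ^ 2))) := by
  let w : ℂ := ⟨x, √(y ^ 2 + z ^ 2)⟩
  have hyz : √(y ^ 2 + z ^ 2) ^ 2 = y ^ 2 + z ^ 2 := Real.sq_sqrt (by positivity)
  have hnormSq : Complex.normSq w = x ^ 2 + y ^ 2 + z ^ 2 := by
    simp only [Complex.normSq_apply, w]; linear_combination hyz
  have hw : ‖w‖ < 1 := by
    rw [← sq_lt_one_iff₀ (norm_nonneg w), ← Complex.normSq_eq_norm_sq, hnormSq]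
    exact h
  have hcw : ‖conj w‖ < 1 := by rwa [Complex.norm_conj]
  have hadd : w + conj w = 2 * x := by rw [Complex.add_conj]; simp [w]
  have hmul : w * conj w = ((x ^ 2 + y ^ 2 + z ^ 2 : ℝ) : ℂ) := by rw [Complex.mul_conj, hnormSq]
  obtain ⟨hs, hsum⟩ := hasSum_coeff_invSqrtSeries_mul hw hcw
  simp only [coeff_invSqrtSeries_mul_eq_legendreT hadd hmul, Complex.norm_real,
    Real.norm_eq_abs] at hs hsum
  refine ⟨hs, ?_⟩
  have hsq := tsum_coeff_invSqrtSeries_sq hw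
  rw [tsum_coeff_invSqrtSeries_conj, Complex.mul_conj, Complex.hasSum_ofReal] at hsum
  set S := ∑' n, PowerSeries.coeff n (invSqrtSeries w)
  have hval : Complex.normSq S ^ 2 = (1 - 2 * x + (x ^ 2 + y ^ 2 + z ^ 2))⁻¹ := by
    rw [← map_pow, hsq, map_inv₀]
    congr 1
    simp only [Complex.normSq_apply, w, Complex.sub_re, Complex.sub_im, Complex.one_re,
      Complex.one_im]
    linear_combination hyz
  rwa [one_div, ← Real.sqrt_inv, ← hval, Real.sqrt_sq (Complex.normSq_nonneg S)]

lemma legendreT_mul (t x y z : ℝ) (n : ℕ) :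
    legendreT (t * x) (t * y) (t * z) n = t ^ n * legendreT x y z n := by
  induction n using Nat.twoStepInduction with
  | zero => simp [legendreT]
  | one => simp [legendreT]
  | more n ih0 ih1 => rw [legendreT, legendreT, ih0, ih1]; ring

/-- Legendre expansion of the gravitational potential around the `L₁` candidate point:
with `X = −γx + μ − 1 + γ`, `Y = −γy`, `Z = γz`, one has
`(1−μ)/r₁ + μ/r₂ = γ² ∑ c_n T_n(x,y,z)`, the series converging absolutely. -/
theorem gravitational_potential_legendre_expansion_L1
    (μ γ : ℝ) (hμ : μ ∈ Set.Ioo (0 : ℝ) 1) (hγ : γ ∈ Set.Ioo (0 : ℝ) 1)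
    (x y z : ℝ) (hρ : Real.sqrt (x ^ 2 + y ^ 2 + z ^ 2) < min 1 ((1 - γ) / γ))
    (X Y Z r₁ r₂ : ℝ)
    (hX : X = -γ * x + μ - 1 + γ) (hY : Y = -γ * y) (hZ : Z = γ * z)
    (hr₁ : r₁ = Real.sqrt ((X - μ) ^ 2 + Y ^ 2 + Z ^ 2))
    (hr₂ : r₂ = Real.sqrt ((X + 1 - μ) ^ 2 + Y ^ 2 + Z ^ 2)) :
    Summable (fun n : ℕ => |γ ^ 2 * cCoeffL1 μ γ n * legendreT x y z n|) ∧
    HasSum (fun n : ℕ => γ ^ 2 * cCoeffL1 μ γ n * legendreT x y z n)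
      ((1 - μ) / r₁ + μ / r₂) := by
  obtain ⟨hγ0, hγ1⟩ := hγ
  have h1γ : 0 < 1 - γ := sub_pos.2 hγ1
  obtain ⟨hρ1, hρ2⟩ := lt_min_iff.1 hρ
  set s := γ / (1 - γ) with hs
  have hs0 : 0 < s := div_pos hγ0 h1γ
  have hball : x ^ 2 + y ^ 2 + z ^ 2 < 1 := by
    rwa [Real.sqrt_lt' one_pos, one_pow] at hρ1
  have hball_scaled : (-s * x) ^ 2 + (-s * y) ^ 2 + (-s * z) ^ 2 < 1 := by
    rw [Real.sqrt_lt' (div_pos h1γ hγ0)] at hρ2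
    have hinv : s ^ 2 * ((1 - γ) / γ) ^ 2 = 1 := by rw [hs]; field_simp
    linarith [mul_lt_mul_of_pos_left hρ2 (pow_pos hs0 2)]
  obtain ⟨habs₂, hsum₂⟩ := hasSum_legendreT hball
  obtain ⟨habs₁, hsum₁⟩ := hasSum_legendreT hball_scaled
  have hr₂_eq : r₂ = γ * √(1 - 2 * x + (x ^ 2 + y ^ 2 + z ^ 2)) := by
    rw [hr₂, ← Real.sqrt_sq hγ0.le, ← Real.sqrt_mul (sq_nonneg γ), hX, hY, hZ]
    congr 1; ring
  have hr₁_eq : r₁ = (1 - γ) * √(1 - 2 * (-s * x)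
      + ((-s * x) ^ 2 + (-s * y) ^ 2 + (-s * z) ^ 2)) := by
    rw [hr₁, ← Real.sqrt_sq h1γ.le, ← Real.sqrt_mul (sq_nonneg _), hX, hY, hZ]
    congr 1
    rw [hs]
    field_simp
    ring
  have hterm (n : ℕ) : γ ^ 2 * cCoeffL1 μ γ n * legendreT x y z n
      = (1 - μ) / (1 - γ) * legendreT (-s * x) (-s * y) (-s * z) n
        + μ / γ * legendreT x y z n := by
    rw [legendreT_mul, cCoeffL1, neg_pow s, hs, div_pow]
    field_simp
    ring
  simp only [hterm]
  constructor
  · exact ((habs₁.of_abs.mul_left _).add (habs₂.of_abs.mul_left _)).abs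
  · have h := (hsum₁.mul_left ((1 - μ) / (1 - γ))).add (hsum₂.mul_left (μ / γ))
    rwa [div_mul_div_comm, div_mul_div_comm, mul_one, mul_one, ← hr₁_eq, ← hr₂_eq] at h
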